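/- With the notation of the operator F below, assume in addition that f₁ is Lipschitz on R with constant L with respect to the sup-norm on ℝ², and fix σ ∈ (0, min(-λ₁, λ₂)). Then for all continuous functions φ̂, φ̃ : ℝ → R, sup_{s ∈ ℝ} e^{-σ|s|}·|F₁(φ̂)(s) - F₁(φ̃)(s)| ≤ ((L + β)/(d₁(λ₂ - σ)(σ - λ₁))) · sup_{s ∈ ℝ} e^{-σ|s|}·max(|φ̂₁(s) - φ̃₁(s)|, |φ̂₂(s) - φ̃₂(s)|). -/

import Mathlib

open Real Filter Set MeasureTheory

/-- `lam1 c β dd < 0` is the negative root of `dd·λ² - c·λ - β = 0`. -/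
noncomputable def lam1 (c β dd : ℝ) : ℝ := (c - Real.sqrt (c ^ 2 + 4 * β * dd)) / (2 * dd)

/-- `lam2 c β dd > 0` is the positive root of `dd·λ² - c·λ - β = 0`. -/
noncomputable def lam2 (c β dd : ℝ) : ℝ := (c + Real.sqrt (c ^ 2 + 4 * β * dd)) / (2 * dd)

/-- `H₁(φ)(s) = β·φ₁(s) + f₁(φ(s))`. -/
noncomputable def Hop1 (β : ℝ) (f1 : ℝ × ℝ → ℝ) (φ1 φ2 : ℝ → ℝ) (s : ℝ) : ℝ :=
  β * φ1 s + f1 (φ1 s, φ2 s)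

/-- `H₂(φ)(s) = β·φ₂(s) + f₂(φ(s))`. -/
noncomputable def Hop2 (β : ℝ) (f2 : ℝ × ℝ → ℝ) (φ1 φ2 : ℝ → ℝ) (s : ℝ) : ℝ :=
  β * φ2 s + f2 (φ1 s, φ2 s)

/-- The operator `F₁`. -/
noncomputable def Fop1 (c d1 β : ℝ) (f1 : ℝ × ℝ → ℝ) (φ1 φ2 : ℝ → ℝ) (s : ℝ) : ℝ :=
  if s ≤ 0 then 0 else
    (1 / (d1 * (lam2 c β d1 - lam1 c β d1))) *
      ((∫ ξ in Set.Ioc (0:ℝ) s,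
          Real.exp (lam1 c β d1 * s) *
            (Real.exp (-(lam1 c β d1 * ξ)) - Real.exp (-(lam2 c β d1 * ξ))) *
            Hop1 β f1 φ1 φ2 ξ) +
       ∫ ξ in Set.Ioi s,
          (Real.exp (lam2 c β d1 * s) - Real.exp (lam1 c β d1 * s)) *
            Real.exp (-(lam2 c β d1 * ξ)) * Hop1 β f1 φ1 φ2 ξ)

/-- The operator `F₂`. -/
noncomputable def Fop2 (c d2 β : ℝ) (f2 : ℝ × ℝ → ℝ) (φ1 φ2 : ℝ → ℝ) (s : ℝ) : ℝ :=
  (1 / (d2 * (lam2 c β d2 - lam1 c β d2))) *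
    ((∫ ξ in Set.Iio s, Real.exp (lam1 c β d2 * (s - ξ)) * Hop2 β f2 φ1 φ2 ξ) +
     ∫ ξ in Set.Ioi s, Real.exp (lam2 c β d2 * (s - ξ)) * Hop2 β f2 φ1 φ2 ξ)

/-- The first (finite interval) kernel integral against `e^{σξ}`. -/
lemma ker_int_Ioc (p q σ s : ℝ) (hpσ : p < σ) (hσq : σ < q) (hs : 0 < s) :
    ∫ ξ in Set.Ioc (0:ℝ) s, Real.exp (p * s) *
        (Real.exp (-(p * ξ)) - Real.exp (-(q * ξ))) * Real.exp (σ * ξ) =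
      Real.exp (p * s) * ((Real.exp ((σ - p) * s) - 1) / (σ - p)
        + (Real.exp ((σ - q) * s) - 1) / (q - σ)) := by
  have h1 : σ - p ≠ 0 := by linarith
  have h2 : q - σ ≠ 0 := by linarith
  rw [← intervalIntegral.integral_of_le hs.le]
  have hd : ∀ x ∈ Set.uIcc 0 s, HasDerivAt (fun x : ℝ => Real.exp (p * s) *
      (Real.exp ((σ - p) * x) / (σ - p) + Real.exp ((σ - q) * x) / (q - σ)))
      (Real.exp (p * s) *
        (Real.exp (-(p * x)) - Real.exp (-(q * x))) * Real.exp (σ * x)) x := by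
    intro x _
    have e1 : HasDerivAt (fun x : ℝ => Real.exp ((σ - p) * x))
        (Real.exp ((σ - p) * x) * ((σ - p) * 1)) x :=
      ((hasDerivAt_id x).const_mul (σ - p)).exp
    have e2 : HasDerivAt (fun x : ℝ => Real.exp ((σ - q) * x))
        (Real.exp ((σ - q) * x) * ((σ - q) * 1)) x :=
      ((hasDerivAt_id x).const_mul (σ - q)).exp
    have := ((e1.div_const (σ - p)).add (e2.div_const (q - σ))).const_mul (Real.exp (p * s))
    refine this.congr_deriv ?_
    have a1 : Real.exp ((σ - p) * x) = Real.exp (-(p * x)) * Real.exp (σ * x) := by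
      rw [← Real.exp_add]; congr 1; ring
    have a2 : Real.exp ((σ - q) * x) = Real.exp (-(q * x)) * Real.exp (σ * x) := by
      rw [← Real.exp_add]; congr 1; ring
    rw [a1, a2]
    field_simp
    ring
  rw [intervalIntegral.integral_eq_sub_of_hasDerivAt hd
    (Continuous.intervalIntegrable (by fun_prop) _ _)]
  simp
  ring

/-- Core estimate of the Green's-kernel integrals. -/
lemma ker_est (p q σ s C B : ℝ) (hp : p < 0) (hσ : 0 < σ) (hσq : σ < q) (hs : 0 < s)
    (h t : ℝ → ℝ) (hh : Continuous h) (ht : Continuous t)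
    (hB : ∀ x, |h x| ≤ B) (tB : ∀ x, |t x| ≤ B) (hC : 0 ≤ C)
    (hd : ∀ x, |h x - t x| ≤ C * Real.exp (σ * |x|)) :
    |((∫ ξ in Set.Ioc (0:ℝ) s, Real.exp (p * s) *
          (Real.exp (-(p * ξ)) - Real.exp (-(q * ξ))) * h ξ) +
       ∫ ξ in Set.Ioi s, (Real.exp (q * s) - Real.exp (p * s)) * Real.exp (-(q * ξ)) * h ξ) -
     ((∫ ξ in Set.Ioc (0:ℝ) s, Real.exp (p * s) *
          (Real.exp (-(p * ξ)) - Real.exp (-(q * ξ))) * t ξ) +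
       ∫ ξ in Set.Ioi s, (Real.exp (q * s) - Real.exp (p * s)) * Real.exp (-(q * ξ)) * t ξ)|
      ≤ C * ((q - p) / ((q - σ) * (σ - p)) * Real.exp (σ * s)) := by
  have hI1 : ∀ g : ℝ → ℝ, Continuous g → IntegrableOn (fun ξ => Real.exp (p * s) *
          (Real.exp (-(p * ξ)) - Real.exp (-(q * ξ))) * g ξ) (Set.Ioc 0 s) := by
    intro g hg
    exact (Continuous.integrableOn_Icc (by fun_prop)).mono_set Set.Ioc_subset_Icc_self
  have hI2 : ∀ g : ℝ → ℝ, Continuous g → (∀ x, |g x| ≤ B) → IntegrableOn (fun ξ =>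
      (Real.exp (q * s) - Real.exp (p * s)) * Real.exp (-(q * ξ)) * g ξ) (Set.Ioi s) := by
    intro g hg hgB
    have h0 : IntegrableOn (fun ξ => (Real.exp (q * s) - Real.exp (p * s)) *
        Real.exp (-(q * ξ))) (Set.Ioi s) := by
      have := (integrableOn_exp_mul_Ioi (a := -q) (by linarith) s).const_mul
        (Real.exp (q * s) - Real.exp (p * s))
      simpa [neg_mul, IntegrableOn] using this
    exact Integrable.mul_bdd (c := B) h0 hg.aestronglyMeasurable
      (Filter.Eventually.of_forall hgB)
  have e1 : ∫ ξ in Set.Ioi s, (Real.exp (q * s) - Real.exp (p * s)) * Real.exp (-(q * ξ))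
      * Real.exp (σ * ξ) = (Real.exp (q * s) - Real.exp (p * s)) *
        (Real.exp ((σ - q) * s) / (q - σ)) := by
    have : ∀ ξ, (Real.exp (q * s) - Real.exp (p * s)) * Real.exp (-(q * ξ))
      * Real.exp (σ * ξ) = (Real.exp (q * s) - Real.exp (p * s)) * Real.exp ((σ - q) * ξ) := by
      intro ξ
      rw [mul_assoc, ← Real.exp_add]; congr 2; ring
    simp_rw [this]
    rw [integral_const_mul, integral_exp_mul_Ioi (by linarith)]
    rw [neg_div, ← div_neg, neg_sub]
  have hJ2 : IntegrableOn (fun ξ => C * ((Real.exp (q * s) - Real.exp (p * s)) *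
      Real.exp (-(q * ξ)) * Real.exp (σ * ξ))) (Set.Ioi s) := by
    have := ((integrableOn_exp_mul_Ioi (a := σ - q) (by linarith) s).const_mul
        (Real.exp (q * s) - Real.exp (p * s))).const_mul C
    refine this.congr (Filter.Eventually.of_forall fun ξ => ?_)
    simp only
    rw [mul_assoc (_ - _), ← Real.exp_add]; congr 3; ring
  have hJ1 : IntegrableOn (fun ξ => C * (Real.exp (p * s) *
      (Real.exp (-(p * ξ)) - Real.exp (-(q * ξ))) * Real.exp (σ * ξ))) (Set.Ioc 0 s) :=
    (hI1 (fun ξ => Real.exp (σ * ξ)) (by fun_prop)).const_mul C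
  have hqp : 0 ≤ Real.exp (q * s) - Real.exp (p * s) := by
    rw [sub_nonneg, Real.exp_le_exp]; nlinarith
  have b1 := norm_integral_le_of_norm_le (f := fun ξ => Real.exp (p * s) *
      (Real.exp (-(p * ξ)) - Real.exp (-(q * ξ))) * h ξ - Real.exp (p * s) *
      (Real.exp (-(p * ξ)) - Real.exp (-(q * ξ))) * t ξ) hJ1 (by
    refine (ae_restrict_iff' measurableSet_Ioc).2 (Filter.Eventually.of_forall fun x hx => ?_)
    have hk : 0 ≤ Real.exp (-(p * x)) - Real.exp (-(q * x)) := by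
      rw [sub_nonneg, Real.exp_le_exp]; nlinarith [hx.1]
    have hk' := mul_nonneg (Real.exp_pos (p * s)).le hk
    rw [← mul_sub, Real.norm_eq_abs, abs_mul, abs_of_nonneg hk']
    have := hd x
    rw [abs_of_pos hx.1] at this
    calc _ ≤ _ := mul_le_mul_of_nonneg_left this hk'
      _ = _ := by ring)
  have b2 := norm_integral_le_of_norm_le (f := fun ξ =>
      (Real.exp (q * s) - Real.exp (p * s)) * Real.exp (-(q * ξ)) * h ξ -
      (Real.exp (q * s) - Real.exp (p * s)) * Real.exp (-(q * ξ)) * t ξ) hJ2 (by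
    refine (ae_restrict_iff' measurableSet_Ioi).2 (Filter.Eventually.of_forall fun x hx => ?_)
    have hk' := mul_nonneg hqp (Real.exp_pos (-(q * x))).le
    rw [← mul_sub, Real.norm_eq_abs, abs_mul, abs_of_nonneg hk']
    have := hd x
    rw [abs_of_pos (hs.trans hx)] at this
    calc _ ≤ _ := mul_le_mul_of_nonneg_left this hk'
      _ = _ := by ring)
  rw [integral_sub (hI1 h hh) (hI1 t ht), integral_const_mul,
    ker_int_Ioc p q σ s (by linarith) hσq hs, Real.norm_eq_abs] at b1
  rw [integral_sub (hI2 h hh hB) (hI2 t ht tB), integral_const_mul, e1, Real.norm_eq_abs] at b2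
  rw [add_sub_add_comm]
  refine (abs_add_le _ _).trans ((add_le_add b1 b2).trans ?_)
  rw [← mul_add]
  refine mul_le_mul_of_nonneg_left ?_ hC
  have h1 : 0 < σ - p := by linarith
  have h2 : 0 < q - σ := by linarith
  have a1 : Real.exp ((σ - p) * s) = Real.exp (σ * s) / Real.exp (p * s) := by
    rw [← Real.exp_sub]; congr 1; ring
  have a2 : Real.exp ((σ - q) * s) = Real.exp (σ * s) / Real.exp (q * s) := by
    rw [← Real.exp_sub]; congr 1; ring
  have key : Real.exp (p * s) * ((Real.exp ((σ - p) * s) - 1) / (σ - p)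
        + (Real.exp ((σ - q) * s) - 1) / (q - σ)) + (Real.exp (q * s) - Real.exp (p * s)) *
        (Real.exp ((σ - q) * s) / (q - σ)) =
      (q - p) / ((q - σ) * (σ - p)) * (Real.exp (σ * s) - Real.exp (p * s)) := by
    rw [a1, a2]
    have := Real.exp_pos (p * s)
    have := Real.exp_pos (q * s)
    field_simp
    ring
  rw [key]
  refine mul_le_mul_of_nonneg_left (by linarith [Real.exp_pos (p * s)]) ?_
  exact div_nonneg (by linarith) (mul_pos h2 h1).le

theorem stmt18 (c d1 d2 β k1 k2 L σ : ℝ) (hc : 0 ≤ c) (hd1 : 0 < d1) (hd2 : 0 < d2)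
    (hβ : 0 < β) (hk1 : 0 < k1) (hk2 : 0 < k2)
    (f1 f2 : ℝ × ℝ → ℝ)
    (hf1 : ContinuousOn f1 (Set.Icc 0 k1 ×ˢ Set.Icc 0 k2))
    (hf2 : ContinuousOn f2 (Set.Icc 0 k1 ×ˢ Set.Icc 0 k2))
    (hH_mono : ∀ u v : ℝ × ℝ, u ∈ Set.Icc 0 k1 ×ˢ Set.Icc 0 k2 →
      v ∈ Set.Icc 0 k1 ×ˢ Set.Icc 0 k2 → u.1 ≤ v.1 → u.2 ≤ v.2 →
      β * u.1 + f1 u ≤ β * v.1 + f1 v ∧ β * u.2 + f2 u ≤ β * v.2 + f2 v)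
    -- `f₁` is Lipschitz on `R` with constant `L` with respect to the sup-norm
    (hL : ∀ u v : ℝ × ℝ, u ∈ Set.Icc 0 k1 ×ˢ Set.Icc 0 k2 →
      v ∈ Set.Icc 0 k1 ×ˢ Set.Icc 0 k2 →
      |f1 u - f1 v| ≤ L * max |u.1 - v.1| |u.2 - v.2|)
    (hσ : 0 < σ) (hσ' : σ < min (-(lam1 c β d1)) (lam2 c β d1))
    (φh1 φh2 φt1 φt2 : ℝ → ℝ)
    (hφh_cont : Continuous φh1 ∧ Continuous φh2)
    (hφt_cont : Continuous φt1 ∧ Continuous φt2)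
    (hφh_mem : ∀ s : ℝ, φh1 s ∈ Set.Icc 0 k1 ∧ φh2 s ∈ Set.Icc 0 k2)
    (hφt_mem : ∀ s : ℝ, φt1 s ∈ Set.Icc 0 k1 ∧ φt2 s ∈ Set.Icc 0 k2) :
    (⨆ s : ℝ, Real.exp (-(σ * |s|)) *
        |Fop1 c d1 β f1 φh1 φh2 s - Fop1 c d1 β f1 φt1 φt2 s|) ≤
      ((L + β) / (d1 * (lam2 c β d1 - σ) * (σ - lam1 c β d1))) *
        ⨆ s : ℝ, Real.exp (-(σ * |s|)) *
          max |φh1 s - φt1 s| |φh2 s - φt2 s| := by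
  have hp : lam1 c β d1 < 0 := by
    have := hσ'.trans_le (min_le_left _ _); linarith
  have hq : σ < lam2 c β d1 := hσ'.trans_le (min_le_right _ _)
  unfold Fop1
  generalize lam1 c β d1 = p at *
  generalize lam2 c β d1 = q at *
  set R : Set (ℝ × ℝ) := Set.Icc 0 k1 ×ˢ Set.Icc 0 k2 with hR
  -- `L ≥ 0`
  have hL0 : 0 ≤ L := by
    have := hL (k1, 0) (0, 0) ⟨⟨hk1.le, le_rfl⟩, ⟨le_rfl, hk2.le⟩⟩
      ⟨⟨le_rfl, hk1.le⟩, ⟨le_rfl, hk2.le⟩⟩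
    simp only [sub_zero, sub_self, abs_zero, abs_of_pos hk1, max_eq_left hk1.le] at this
    have h0 := (abs_nonneg _).trans this
    by_contra hneg
    push Not at hneg
    nlinarith
  set m : ℝ → ℝ := fun s => max |φh1 s - φt1 s| |φh2 s - φt2 s| with hm
  have hmR : ∀ s, m s ≤ max k1 k2 := by
    intro s
    obtain ⟨⟨a1, a2⟩, ⟨a3, a4⟩⟩ := hφh_mem s
    obtain ⟨⟨b1, b2⟩, ⟨b3, b4⟩⟩ := hφt_mem s
    exact max_le_max (abs_le.2 ⟨by linarith, by linarith⟩) (abs_le.2 ⟨by linarith, by linarith⟩)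
  have hm0 : ∀ s, 0 ≤ m s := fun s => le_max_of_le_left (abs_nonneg _)
  have hbdd : BddAbove (Set.range fun s : ℝ => Real.exp (-(σ * |s|)) * m s) := by
    refine ⟨max k1 k2, ?_⟩
    rintro _ ⟨s, rfl⟩
    have : Real.exp (-(σ * |s|)) ≤ 1 := Real.exp_le_one_iff.2 (by
      have := mul_nonneg hσ.le (abs_nonneg s); linarith)
    calc _ ≤ 1 * m s := mul_le_mul_of_nonneg_right this (hm0 s)
      _ ≤ _ := by rw [one_mul]; exact hmR s
  set M := ⨆ s : ℝ, Real.exp (-(σ * |s|)) * m s with hM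
  have hle : ∀ s, m s ≤ M * Real.exp (σ * |s|) := by
    intro s
    have h1 : Real.exp (-(σ * |s|)) * m s ≤ M := le_ciSup hbdd s
    rw [Real.exp_neg, inv_mul_le_iff₀ (Real.exp_pos _)] at h1
    linarith
  have hM0 : 0 ≤ M := Real.iSup_nonneg fun s => mul_nonneg (Real.exp_pos _).le (hm0 s)
  have hmemh : ∀ s, (φh1 s, φh2 s) ∈ R := fun s => ⟨(hφh_mem s).1, (hφh_mem s).2⟩
  have hmemt : ∀ s, (φt1 s, φt2 s) ∈ R := fun s => ⟨(hφt_mem s).1, (hφt_mem s).2⟩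
  have hcg : ContinuousOn (fun u : ℝ × ℝ => β * u.1 + f1 u) R :=
    ContinuousOn.add (by fun_prop) hf1
  obtain ⟨B, hB⟩ := (isCompact_Icc.prod isCompact_Icc : IsCompact R).exists_bound_of_continuousOn hcg
  have hch : Continuous (Hop1 β f1 φh1 φh2) :=
    hcg.comp_continuous (hφh_cont.1.prodMk hφh_cont.2) hmemh
  have hct : Continuous (Hop1 β f1 φt1 φt2) :=
    hcg.comp_continuous (hφt_cont.1.prodMk hφt_cont.2) hmemt
  have hdiff : ∀ x, |Hop1 β f1 φh1 φh2 x - Hop1 β f1 φt1 φt2 x| ≤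
      ((L + β) * M) * Real.exp (σ * |x|) := by
    intro x
    have h1 := hL _ _ (hmemh x) (hmemt x)
    have h2 : |φh1 x - φt1 x| ≤ m x := le_max_left _ _
    have h3 : Hop1 β f1 φh1 φh2 x - Hop1 β f1 φt1 φt2 x =
        β * (φh1 x - φt1 x) + (f1 (φh1 x, φh2 x) - f1 (φt1 x, φt2 x)) := by
      unfold Hop1; ring
    rw [h3]
    calc _ ≤ |β * (φh1 x - φt1 x)| + |f1 (φh1 x, φh2 x) - f1 (φt1 x, φt2 x)| := abs_add_le _ _
      _ ≤ β * m x + L * m x := by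
        rw [abs_mul, abs_of_pos hβ]
        exact add_le_add (mul_le_mul_of_nonneg_left h2 hβ.le) h1
      _ = (L + β) * m x := by ring
      _ ≤ (L + β) * (M * Real.exp (σ * |x|)) :=
        mul_le_mul_of_nonneg_left (hle x) (by linarith)
      _ = _ := by ring
  have hqσ : 0 < q - σ := by linarith
  have hσp : 0 < σ - p := by linarith
  have hqp : 0 < q - p := by linarith
  have hK : 0 ≤ (L + β) / (d1 * (q - σ) * (σ - p)) :=
    div_nonneg (by linarith) (by positivity)
  refine ciSup_le fun s => ?_
  by_cases hs : s ≤ 0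
  · simp only [hs, if_true, sub_self, abs_zero, mul_zero]
    exact mul_nonneg hK hM0
  · simp only [hs, if_false]
    push Not at hs
    have := ker_est p q σ s ((L + β) * M) B hp hσ hq hs _ _ hch hct
      (fun x => hB _ (hmemh x)) (fun x => hB _ (hmemt x)) (mul_nonneg (by linarith) hM0) hdiff
    have hA : 0 < 1 / (d1 * (q - p)) := by positivity
    rw [← mul_sub, abs_mul, abs_of_pos hA, abs_of_pos hs]
    calc _ ≤ Real.exp (-(σ * s)) * (1 / (d1 * (q - p)) *
          ((L + β) * M * ((q - p) / ((q - σ) * (σ - p)) * Real.exp (σ * s)))) := by gcongr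
      _ = _ := by
        rw [Real.exp_neg]
        have := Real.exp_pos (σ * s)
        field_simp
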